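/- arXiv:1611.09493 — 3 statements merged into one kernel-verified Lean document; each statement's English description precedes it below -/
import Mathlib

section
/- Let (X,𝒰) be a sequentially compact uniform space, let f : X → X be a homeomorphism, and let α = 𝒞(U) = {U[x] : x ∈ F} (F finite, ⋃_{x∈F} U[x] = X) be a uniform generator for f. Then for each entourage E of X there exists n > 0 such that every element A of the join ⋁_{i=−n}^{n} f^{−i}(α) satisfies A ⊆ E[x] for some point x ∈ A. -/
open Set Filter UniformSpace Uniformity

/-- The uniform cover `{U[x] : x ∈ F}` (with `F` finite and `⋃ x ∈ F, U[x] = X`) is a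
uniform generator for the homeomorphism `f`: every bi-infinite sequence of members of the
cover has `⋂ n, f^{-n}(cl Aₙ)` containing at most one point. -/
def IsUniformGenerator {X : Type*} [UniformSpace X] (f : Equiv.Perm X) (U : Set (X × X))
    (F : Set X) : Prop :=
  F.Finite ∧ (⋃ x ∈ F, ball x U = Set.univ) ∧
    ∀ A : ℤ → Set X, (∀ n : ℤ, ∃ x ∈ F, A n = ball x U) →
      Set.Subsingleton (⋂ n : ℤ, (f ^ n : Equiv.Perm X) ⁻¹' closure (A n))

theorem Equiv.Perm.continuous_zpow {X : Type*} [TopologicalSpace X] {f : Equiv.Perm X}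
    (hf : Continuous f) (hf' : Continuous f.symm) (i : ℤ) :
    Continuous (f ^ i : Equiv.Perm X) := by
  induction i using Int.induction_on with
  | zero => exact continuous_id
  | succ k ih =>
    rw [zpow_add_one]
    exact ih.comp hf
  | pred k ih =>
    rw [zpow_sub_one]
    exact ih.comp hf'

/-- If two convergent sequences eventually share a member of a finite family of sets, then
their limits share the closure of a single member. -/
theorem exists_mem_closure_of_finite_of_tendsto {X Y ι : Type*} [TopologicalSpace Y]
    {l : Filter ι} [l.NeBot] {F : Set X} (hF : F.Finite) {B : X → Set Y} {u v : ι → Y} {a b : Y}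
    (hu : Tendsto u l (nhds a)) (hv : Tendsto v l (nhds b))
    (h : ∀ᶠ n in l, ∃ c ∈ F, u n ∈ B c ∧ v n ∈ B c) :
    ∃ c ∈ F, a ∈ closure (B c) ∧ b ∈ closure (B c) := by
  have hfreq : ∃ c ∈ F, ∃ᶠ n in l, u n ∈ B c ∧ v n ∈ B c := by
    by_contra! hcon
    obtain ⟨n, ⟨c, hc, hn⟩, hn'⟩ := (h.and ((eventually_all_finite hF).2 hcon)).exists
    exact hn' c hc hn.1 hn.2
  obtain ⟨c, hc, hfc⟩ := hfreq
  exact ⟨c, hc, mem_closure_of_frequently_of_tendsto (hfc.mono fun _ h => h.1) hu,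
    mem_closure_of_frequently_of_tendsto (hfc.mono fun _ h => h.2) hv⟩

/-- Let `X` be a sequentially compact uniform space, `f` a homeomorphism of `X` and
`α = {U[x] : x ∈ F}` a uniform generator for `f`. Then for each entourage `E` there is
`n > 0` such that every (nonempty) element `A = ⋂_{i=-n}^{n} f^{-i}(Aᵢ)` of the join
`⋁_{i=-n}^{n} f^{-i}(α)` satisfies `A ⊆ E[x]` for some `x ∈ A`. -/
theorem uniformGenerator_join_small {X : Type*} [UniformSpace X] [SeqCompactSpace X]
    (f : Equiv.Perm X) (hf : Continuous f) (hf' : Continuous f.symm)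
    (U : Set (X × X)) (hU : U ∈ 𝓤 X) (F : Set X) (hgen : IsUniformGenerator f U F) :
    ∀ E ∈ 𝓤 X, ∃ n : ℕ, 0 < n ∧
      ∀ g : ℤ → Set X, (∀ i ∈ Finset.Icc (-(n : ℤ)) (n : ℤ), ∃ x ∈ F, g i = ball x U) →
        ∀ A : Set X, A = ⋂ i ∈ Finset.Icc (-(n : ℤ)) (n : ℤ),
            (f ^ i : Equiv.Perm X) ⁻¹' g i →
          A.Nonempty → ∃ x ∈ A, A ⊆ ball x E := by
  obtain ⟨hF, -, hsub⟩ := hgen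
  intro E hE
  by_contra! hcon
  have hpair : ∀ n : ℕ, ∃ x y : X, (x, y) ∉ E ∧
      ∀ i ∈ Finset.Icc (-((n + 1 : ℕ) : ℤ)) ((n + 1 : ℕ) : ℤ), ∃ c ∈ F,
        (f ^ i : Equiv.Perm X) x ∈ ball c U ∧ (f ^ i : Equiv.Perm X) y ∈ ball c U := by
    intro n
    obtain ⟨g, hg, A, rfl, ⟨x, hx⟩, hA⟩ := hcon (n + 1) n.succ_pos
    obtain ⟨y, hy, hxy⟩ := Set.not_subset.1 (hA x hx)
    refine ⟨x, y, hxy, fun i hi => ?_⟩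
    obtain ⟨c, hc, hgc⟩ := hg i hi
    have hx' := Set.mem_iInter₂.1 hx i hi
    have hy' := Set.mem_iInter₂.1 hy i hi
    rw [Set.mem_preimage, hgc] at hx' hy'
    exact ⟨c, hc, hx', hy'⟩
  choose x y hxy hshare using hpair
  obtain ⟨a, φ, hφ, hxa⟩ := SeqCompactSpace.tendsto_subseq x
  obtain ⟨b, ψ, hψ, hyb⟩ := SeqCompactSpace.tendsto_subseq (y ∘ φ)
  have hxa' := hxa.comp hψ.tendsto_atTop
  have hlim : ∀ i : ℤ, ∃ c ∈ F, (f ^ i : Equiv.Perm X) a ∈ closure (ball c U) ∧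
      (f ^ i : Equiv.Perm X) b ∈ closure (ball c U) := by
    intro i
    have hcont := Equiv.Perm.continuous_zpow hf hf' i
    refine exists_mem_closure_of_finite_of_tendsto hF ((hcont.tendsto a).comp hxa')
      ((hcont.tendsto b).comp hyb) ?_
    filter_upwards [(hφ.comp hψ).tendsto_atTop.eventually_ge_atTop i.natAbs] with n hn
    refine hshare (φ (ψ n)) i (Finset.mem_Icc.2 ?_)
    simp only [Function.comp_apply] at hn
    omega
  choose c hc hac hbc using hlim
  have hab : a = b := hsub (fun i => ball (c i) U) (fun i => ⟨c i, hc i, rfl⟩)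
    (Set.mem_iInter.2 hac) (Set.mem_iInter.2 hbc)
  subst hab
  have hE' := (hxa'.prodMk_nhds hyb).eventually (nhds_le_uniformity a hE)
  obtain ⟨n, hn⟩ := hE'.exists
  exact hxy _ hn
end

section
/- Let (X,𝒰) be a compact uniform space and let f : X → X be a continuous map. Then the set of entropy points is forward invariant: f(Ent(X,f)) ⊆ Ent(X,f). -/
open Set Filter UniformSpace Uniformity ENNReal

/-- `A` is an `(n,E,f)`-separated subset of `K`: any two distinct points of `A` are
`E`-separated at some time `i < n`. -/
def IsSeparatedIn {X : Type*} (f : X → X) (K : Set X) (E : Set (X × X)) (n : ℕ)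
    (A : Set X) : Prop :=
  A ⊆ K ∧ ∀ x ∈ A, ∀ y ∈ A, x ≠ y → ∃ i < n, (f^[i] x, f^[i] y) ∉ E

/-- `sep(n,E,f,K)`: the maximal cardinality of an `(n,E,f)`-separated subset of `K`. -/
noncomputable def sepMaxcard {X : Type*} (f : X → X) (K : Set X) (E : Set (X × X))
    (n : ℕ) : ℕ∞ :=
  ⨆ (A : Set X) (_ : IsSeparatedIn f K E n A), A.encard

/-- The exponential growth rate of `sep(n,E,f,K)` at a fixed entourage `E`. -/
noncomputable def sepEntropyEntourage {X : Type*} (f : X → X) (K : Set X)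
    (E : Set (X × X)) : EReal :=
  Filter.atTop.limsup fun n : ℕ => ENNReal.log (sepMaxcard f K E n) / n

/-- The uniform entropy `h_u(f,K)`: supremum over entourages of the exponential growth
rate of maximal separated sets. -/
noncomputable def unifEntropy {X : Type*} [UniformSpace X] (f : X → X) (K : Set X) : EReal :=
  ⨆ E ∈ 𝓤 X, sepEntropyEntourage f K E

/-- The set of entropy points of `f`: points all of whose neighborhood closures carry
positive uniform entropy. -/
def entropyPoints {X : Type*} [UniformSpace X] (f : X → X) : Set X :=
  {x | ∀ V : Set X, IsOpen V → x ∈ V → 0 < unifEntropy f (closure V)}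

theorem IsSeparatedIn.encard_le_sepMaxcard {X : Type*} {f : X → X} {K A : Set X}
    {E : Set (X × X)} {n : ℕ} (hA : IsSeparatedIn f K E n A) :
    A.encard ≤ sepMaxcard f K E n :=
  le_iSup₂_of_le A hA le_rfl

/-- The part of a separated set lying in an `E`-small set has cardinality at most that of a
separated subset of any set containing its image. -/
theorem IsSeparatedIn.encard_inter_le {X : Type*} {f : X → X} {K L A W : Set X}
    {E : Set (X × X)} {n : ℕ} (hE : ∀ x, (x, x) ∈ E) (hKL : MapsTo f K L)
    (hA : IsSeparatedIn f K E n A) (hW : W ×ˢ W ⊆ E) :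
    (A ∩ W).encard ≤ sepMaxcard f L E n := by
  have key : ∀ x ∈ A ∩ W, ∀ y ∈ A ∩ W, x ≠ y →
      ∃ i < n, (f^[i] (f x), f^[i] (f y)) ∉ E := by
    rintro x ⟨hxA, hxW⟩ y ⟨hyA, hyW⟩ hxy
    obtain ⟨i, hi, hiE⟩ := hA.2 x hxA y hyA hxy
    cases i with
    | zero => exact absurd (hW ⟨hxW, hyW⟩) hiE
    | succ i => exact ⟨i, by lia, hiE⟩
  have hinj : InjOn f (A ∩ W) := by
    intro x hx y hy hxy
    by_contra hne
    obtain ⟨i, -, hiE⟩ := key x hx y hy hne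
    exact hiE (hxy ▸ hE _)
  rw [← hinj.encard_image]
  refine IsSeparatedIn.encard_le_sepMaxcard ⟨?_, ?_⟩
  · rintro _ ⟨x, hx, rfl⟩
    exact hKL (hA.1 hx.1)
  · rintro _ ⟨x, hx, rfl⟩ _ ⟨y, hy, rfl⟩ hxy
    exact key x hx y hy fun h => hxy (h ▸ rfl)

theorem exists_finset_cover_prod_subset {X : Type*} [UniformSpace X] [CompactSpace X]
    {E : Set (X × X)} (hE : E ∈ 𝓤 X) :
    ∃ (t : Finset X) (W : X → Set X), (∀ y, W y ×ˢ W y ⊆ E) ∧ ⋃ y ∈ t, W y = univ := by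
  obtain ⟨d, hd, hsymm, hdE⟩ := comp_symm_mem_uniformity_sets hE
  obtain ⟨t, ht, hcov⟩ := (isCompact_univ (X := X)).totallyBounded d hd
  refine ⟨ht.toFinset, fun y => {x | (x, y) ∈ d}, ?_, ?_⟩
  · rintro y ⟨a, b⟩ ⟨ha, hb⟩
    exact hdE ⟨y, ha, hsymm.symm _ _ hb⟩
  · simpa [univ_subset_iff] using hcov

theorem sepEntropyEntourage_le_of_mapsTo {X : Type*} [UniformSpace X] [CompactSpace X]
    {f : X → X} {K L : Set X} (hKL : MapsTo f K L) {E : Set (X × X)} (hE : E ∈ 𝓤 X) :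
    sepEntropyEntourage f K E ≤ sepEntropyEntourage f L E := by
  obtain ⟨t, W, hW, hcov⟩ := exists_finset_cover_prod_subset hE
  have hcard (n : ℕ) : sepMaxcard f K E n ≤ t.card * sepMaxcard f L E n := by
    refine iSup₂_le fun A hA => ?_
    calc A.encard = (⋃ y ∈ t, A ∩ W y).encard := by
          rw [← inter_iUnion₂, hcov, inter_univ]
      _ ≤ ∑ y ∈ t, (A ∩ W y).encard := t.set_encard_biUnion_le _
      _ ≤ ∑ _y ∈ t, sepMaxcard f L E n :=
          Finset.sum_le_sum fun y _ =>
            hA.encard_inter_le (fun _ => refl_mem_uniformity hE) hKL (hW y)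
      _ = t.card * sepMaxcard f L E n := by simp
  refine ExpGrowth.expGrowthSup_le_of_eventually_le (b := (t.card : ℝ≥0∞))
    (ENNReal.natCast_ne_top _) (Eventually.of_forall fun n => ?_)
  exact_mod_cast hcard n

theorem unifEntropy_le_of_mapsTo {X : Type*} [UniformSpace X] [CompactSpace X]
    {f : X → X} {K L : Set X} (hKL : MapsTo f K L) :
    unifEntropy f K ≤ unifEntropy f L :=
  iSup₂_mono fun _ hE => sepEntropyEntourage_le_of_mapsTo hKL hE

/-- For a continuous map `f` of a compact uniform space, the set of entropy points is
forward invariant: `f(Ent(X,f)) ⊆ Ent(X,f)`. -/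
theorem entropyPoints_forward_invariant {X : Type*} [UniformSpace X] [CompactSpace X]
    (f : X → X) (hf : Continuous f) : f '' entropyPoints f ⊆ entropyPoints f := by
  rintro _ ⟨x, hx, rfl⟩ V hV hxV
  exact (hx (f ⁻¹' V) (hV.preimage hf) hxV).trans_le
    (unifEntropy_le_of_mapsTo (hf.closure_preimage_subset V))
end

section
/- Let (X,𝒰) be a locally compact separated (Hausdorff) uniform space and let f : X → X be a continuous map with the topological shadowing property. Let Y ⊆ X be a closed f-invariant set, let g = f|_Y and G = g × g : Y × Y → Y × Y. Suppose there is a point x ∈ Y such that g has sensitive dependence at x (there is an entourage V of X such that for every entourage W there exist y ∈ Y with (x,y) ∈ W and n ∈ ℕ with (gⁿ(x), gⁿ(y)) ∉ V) and (x,x) lies in the interior of the closure of the chain recurrent set R(G) of G (taken in Y × Y). Then x is an entropy point of f and consequently h_u(f) > 0. -/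
open Set Filter UniformSpace Uniformity ENNReal

/-- `f` has the topological shadowing property: for every entourage `E` there is an
entourage `D` such that every `D`-pseudo-orbit is `E`-shadowed by some point. -/
def TopologicalShadowing {X : Type*} [UniformSpace X] (f : X → X) : Prop :=
  ∀ E ∈ 𝓤 X, ∃ D ∈ 𝓤 X, ∀ u : ℕ → X, (∀ n : ℕ, (f (u n), u (n + 1)) ∈ D) →
    ∃ w : X, ∀ n : ℕ, (f^[n] w, u n) ∈ E

/-- The chain recurrent set of a self-map `G` of a uniform space: points `p` admitting,
for every entourage `D`, a `D`-pseudo-orbit chain of length `k ≥ 1` from `p` back to `p`. -/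
def chainRecurrentSet {Z : Type*} [UniformSpace Z] (G : Z → Z) : Set Z :=
  {p | ∀ D ∈ 𝓤 Z, ∃ k : ℕ, 1 ≤ k ∧ ∃ v : ℕ → Z, v 0 = p ∧ v k = p ∧
    ∀ i < k, (G (v i), v (i + 1)) ∈ D}

/-- A sufficiently fine pseudo-orbit of a continuous map follows the true orbit of its initial
point for a prescribed number of steps. -/
theorem exists_entourage_pseudoOrbit_follows {Z : Type*} [UniformSpace Z] {G : Z → Z}
    (hG : Continuous G) (z : Z) (n : ℕ) {E : Set (Z × Z)} (hE : E ∈ 𝓤 Z) :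
    ∃ D ∈ 𝓤 Z, ∀ v : ℕ → Z, v 0 = z → (∀ i < n, (G (v i), v (i + 1)) ∈ D) →
      (G^[n] z, v n) ∈ E := by
  induction n generalizing E with
  | zero =>
    refine ⟨univ, univ_mem, fun v hv _ => ?_⟩
    rw [hv]
    exact refl_mem_uniformity hE
  | succ n ih =>
    obtain ⟨E₁, hE₁, hE₁E⟩ := comp_mem_uniformity_sets hE
    have hcont : {q | (G (G^[n] z), G q) ∈ E₁} ∈ nhds (G^[n] z) :=
      hG.continuousAt (UniformSpace.ball_mem_nhds _ hE₁)
    obtain ⟨E₂, hE₂, hE₂G⟩ := UniformSpace.mem_nhds_iff.1 hcont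
    obtain ⟨D, hD, hDn⟩ := ih hE₂
    refine ⟨D ∩ E₁, inter_mem hD hE₁, fun v hv hstep => ?_⟩
    rw [Function.iterate_succ_apply']
    exact hE₁E ⟨G (v n), hE₂G (hDn v hv fun i hi => (hstep i (by omega)).1),
      (hstep n (by omega)).2⟩

/-- A chain recurrent point has closed chains that are longer than a prescribed time `n` and
that are still close to the true orbit at time `n`. -/
theorem exists_closed_chain_of_mem_chainRecurrentSet {Z : Type*} [UniformSpace Z] {G : Z → Z}
    (hG : Continuous G) {p : Z} (hp : p ∈ chainRecurrentSet G) (n : ℕ) {D E : Set (Z × Z)}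
    (hD : D ∈ 𝓤 Z) (hE : E ∈ 𝓤 Z) :
    ∃ k > n, ∃ v : ℕ → Z, v 0 = p ∧ v k = p ∧ (∀ i, (G (v i), v (i + 1)) ∈ D) ∧
      (G^[n] p, v n) ∈ E := by
  obtain ⟨D', hD', hfollow⟩ := exists_entourage_pseudoOrbit_follows hG p n hE
  obtain ⟨k, hk, v, hv0, hvk, hstep⟩ := hp (D ∩ D') (inter_mem hD hD')
  have hper : ∀ i, (G (v (i % k)), v ((i + 1) % k)) ∈ D ∩ D' := by
    intro i
    have hlt : i % k < k := Nat.mod_lt _ (by omega)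
    have hmod : v ((i + 1) % k) = v (i % k + 1) := by
      rw [← Nat.mod_add_mod]
      rcases Nat.lt_or_ge (i % k + 1) k with h | h
      · rw [Nat.mod_eq_of_lt h]
      · rw [show i % k + 1 = k by omega, Nat.mod_self, hv0, hvk]
    rw [hmod]
    exact hstep _ hlt
  refine ⟨k * (n + 1), ?_, fun i => v (i % k), by simpa using hv0, by simpa using hv0,
    fun i => (hper i).1, hfollow _ (by simpa using hv0) fun i _ => (hper i).2⟩
  nlinarith

/-- If every concatenation of two pseudo-orbit blocks of length `k` is shadowed from `S`, and the
two blocks are far apart at some time `n < k`, then `S` carries positive entropy. -/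
theorem sepEntropyEntourage_pos_of_blocks {X : Type*} {f : X → X} {S : Set X}
    {E : Set (X × X)} (hrefl : ∀ p, (p, p) ∈ E) {k n : ℕ} (hn : n < k) (c : Bool → ℕ → X)
    (hsep : ∀ s t, s ≠ t → ∀ p q, (p, c s n) ∈ E → (q, c t n) ∈ E → (p, q) ∉ E)
    (hshadow : ∀ s : ℕ → Bool, ∃ w ∈ S, ∀ m, (f^[m] w, c (s (m / k)) (m % k)) ∈ E) :
    0 < sepEntropyEntourage f S E := by
  choose w hwS hw using hshadow
  have hk : 0 < k := by omega
  have hcard : ∀ N : ℕ, ((2 ^ N : ℕ) : ℕ∞) ≤ sepMaxcard f S E (N * k) := by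
    intro N
    let extendFalse : (Fin N → Bool) → ℕ → Bool := fun s i => if h : i < N then s ⟨i, h⟩ else false
    have key : ∀ s t : Fin N → Bool, s ≠ t →
        ∃ i < N * k, (f^[i] (w (extendFalse s)), f^[i] (w (extendFalse t))) ∉ E := by
      intro s t hst
      obtain ⟨j, hj⟩ := Function.ne_iff.1 hst
      have hdiv : (j * k + n) / k = j := by
        rw [Nat.add_comm, Nat.add_mul_div_right _ _ hk, Nat.div_eq_of_lt hn, Nat.zero_add]
      have hmod : (j * k + n) % k = n := by
        rw [Nat.add_comm, Nat.add_mul_mod_self_right, Nat.mod_eq_of_lt hn]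
      refine ⟨j * k + n, ?_, hsep (extendFalse s j) (extendFalse t j) ?_ _ _ ?_ ?_⟩
      · have := Nat.mul_le_mul_right k (Nat.succ_le_of_lt j.2)
        rw [Nat.succ_mul] at this
        omega
      · simpa [extendFalse] using hj
      · simpa only [hdiv, hmod] using hw (extendFalse s) (j * k + n)
      · simpa only [hdiv, hmod] using hw (extendFalse t) (j * k + n)
    have hinj : Function.Injective fun s : Fin N → Bool => w (extendFalse s) := by
      intro s t hst
      by_contra hne
      obtain ⟨i, -, hi⟩ := key s t hne
      apply hi
      rw [show w (extendFalse s) = w (extendFalse t) from hst]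
      exact hrefl _
    have hrange : IsSeparatedIn f S E (N * k) (range fun s : Fin N → Bool => w (extendFalse s)) := by
      refine ⟨?_, ?_⟩
      · rintro _ ⟨s, rfl⟩
        exact hwS _
      · rintro _ ⟨s, rfl⟩ _ ⟨t, rfl⟩ hne
        exact key s t fun h => hne (by rw [h])
    have hencard : (range fun s : Fin N → Bool => w (extendFalse s)).encard = ((2 ^ N : ℕ) : ℕ∞) := by
      rw [← image_univ, hinj.encard_image, encard_univ, ENat.card_eq_coe_fintype_card]
      simp
    rw [← hencard]
    exact le_iSup₂_of_le _ hrange le_rfl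
  have hlog : 0 < Real.log 2 / k := div_pos (Real.log_pos one_lt_two) (by exact_mod_cast hk)
  refine lt_of_lt_of_le (EReal.coe_pos.2 hlog) (le_limsup_of_frequently_le ?_)
  rw [frequently_atTop]
  intro M
  refine ⟨(M + 1) * k, by nlinarith, ?_⟩
  have hmono : ENNReal.log ((2 : ENNReal) ^ (M + 1)) ≤
      ENNReal.log (sepMaxcard f S E ((M + 1) * k)) := by
    apply ENNReal.log_monotone
    have := ENat.toENNReal_le.2 (hcard (M + 1))
    simpa using this
  have hlog2 : ENNReal.log ((2 : ENNReal) ^ (M + 1)) = (((M + 1 : ℕ) * Real.log 2 : ℝ) : EReal) := by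
    rw [ENNReal.log_pow, ENNReal.log_pos_real' (by simp)]
    simp [EReal.coe_mul]
  refine le_trans (le_of_eq ?_) (EReal.monotone_div_right_of_nonneg (by positivity) hmono)
  beta_reduce
  rw [hlog2, ← EReal.coe_coe_eq_natCast, ← EReal.coe_div]
  congr 1
  push_cast
  have : (k : ℝ) ≠ 0 := by positivity
  have : (M : ℝ) + 1 ≠ 0 := by positivity
  field_simp

/-- A concatenation of blocks of length `k` is a pseudo-orbit when each block is one and the end
of any block can be followed by the start of any block. -/
theorem pseudoOrbit_concat {X : Type*} {f : X → X} {D : Set (X × X)} {k : ℕ} (hk : 0 < k)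
    (c : Bool → ℕ → X) (hstep : ∀ s i, i + 1 < k → (f (c s i), c s (i + 1)) ∈ D)
    (hjoin : ∀ s t, (f (c s (k - 1)), c t 0) ∈ D) (s : ℕ → Bool) (m : ℕ) :
    (f (c (s (m / k)) (m % k)), c (s ((m + 1) / k)) ((m + 1) % k)) ∈ D := by
  have hlt : m % k < k := Nat.mod_lt _ hk
  have hdm := Nat.div_add_mod m k
  rcases Nat.lt_or_ge (m % k + 1) k with h | h
  · have hsum : m + 1 = (m % k + 1) + k * (m / k) := by omega
    have hdiv : (m + 1) / k = m / k := by
      rw [hsum, Nat.add_mul_div_left _ _ hk, Nat.div_eq_of_lt h, Nat.zero_add]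
    have hmod : (m + 1) % k = m % k + 1 := by
      rw [hsum, Nat.add_mul_mod_self_left, Nat.mod_eq_of_lt h]
    rw [hdiv, hmod]
    exact hstep _ _ h
  · have hmod : (m + 1) % k = 0 := by
      rw [← Nat.mod_add_mod, show m % k + 1 = k by omega, Nat.mod_self]
    rw [hmod, show m % k = k - 1 by omega]
    exact hjoin _ _

/-- Let `X` be a locally compact separated uniform space and `f : X → X` a continuous map
with the topological shadowing property. Let `Y ⊆ X` be a closed `f`-invariant set,
`g = f|_Y` and `G = g × g`. If there is `x ∈ Y` at which `g` has sensitive dependence and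
`(x,x)` lies in the interior of the closure of the chain recurrent set `R(G)` in `Y × Y`,
then `x` is an entropy point of `f` and `h_u(f) > 0`. -/
theorem entropyPoint_of_shadowing {X : Type*} [UniformSpace X] [T2Space X]
    [LocallyCompactSpace X] (f : X → X) (hf : Continuous f)
    (hsh : TopologicalShadowing f)
    (Y : Set X) (hYclosed : IsClosed Y) (hYinv : Set.MapsTo f Y Y)
    (x : X) (hxY : x ∈ Y)
    (hsen : ∃ V ∈ 𝓤 X, ∀ W ∈ 𝓤 X, ∃ y ∈ Y, (x, y) ∈ W ∧
      ∃ n : ℕ, (f^[n] x, f^[n] y) ∉ V)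
    (hrec : ((⟨x, hxY⟩ : Y), (⟨x, hxY⟩ : Y)) ∈
      interior (closure (chainRecurrentSet (Prod.map (hYinv.restrict f Y Y)
        (hYinv.restrict f Y Y))))) :
    x ∈ entropyPoints f ∧ 0 < unifEntropy f Set.univ := by
  suffices hx : x ∈ entropyPoints f by
    refine ⟨hx, ?_⟩
    simpa using hx univ isOpen_univ (mem_univ x)
  intro O hO hxO
  obtain ⟨V, hV, hsens⟩ := hsen
  set g := hYinv.restrict f Y Y
  have hgc : Continuous g := hf.restrict hYinv
  have hiter : ∀ (n : ℕ) (p : Y × Y), (Prod.map g g)^[n] p = (g^[n] p.1, g^[n] p.2) := by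
    intro n p
    rw [Prod.map_iterate]
    rfl
  have hcoe : ∀ (n : ℕ) (p : Y), ((g^[n] p : Y) : X) = f^[n] p := by
    intro n
    induction n with
    | zero => intro p; rfl
    | succ n ih => intro p; rw [Function.iterate_succ_apply, Function.iterate_succ_apply, ih]; rfl
  -- a symmetric entourage `E` whose eightfold composite lies in `V`
  obtain ⟨V₁, hV₁, -, hV₁V⟩ := comp_symm_mem_uniformity_sets hV
  obtain ⟨V₂, hV₂, -, hV₂V⟩ := comp_symm_mem_uniformity_sets hV₁
  obtain ⟨V₃, hV₃, hV₃s, hV₃V⟩ := comp_symm_mem_uniformity_sets hV₂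
  obtain ⟨U, hU, hUO⟩ := UniformSpace.mem_nhds_iff.1 (hO.mem_nhds hxO)
  obtain ⟨U₁, hU₁, hU₁s, hU₁U⟩ := comp_symm_mem_uniformity_sets hU
  obtain ⟨E, hE, hEs, hEV⟩ : ∃ E ∈ 𝓤 X, (∀ p q, (p, q) ∈ E → (q, p) ∈ E) ∧ E ⊆ V₃ ∩ U₁ :=
    ⟨V₃ ∩ U₁, inter_mem hV₃ hU₁,
      fun p q h => ⟨hV₃s.symm _ _ h.1, hU₁s.symm _ _ h.2⟩, Subset.rfl⟩
  have hE8 : ∀ a₀ a₁ a₂ a₃ a₄ a₅ a₆ a₇, (a₀, a₁) ∈ E → (a₁, a₂) ∈ E → (a₂, a₃) ∈ E →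
      (a₃, a₄) ∈ E → (a₄, a₅) ∈ E → (a₅, a₆) ∈ E → (a₆, a₇) ∈ E → (a₀, a₇) ∈ V := by
    intro a₀ a₁ a₂ a₃ a₄ a₅ a₆ a₇ h₀ h₁ h₂ h₃ h₄ h₅ h₆
    have two : ∀ {p q r}, (p, q) ∈ E → (q, r) ∈ E → (p, r) ∈ V₂ :=
      fun {p q r} h h' => hV₃V ⟨q, (hEV h).1, (hEV h').1⟩
    exact hV₁V ⟨a₄, hV₂V ⟨a₂, two h₀ h₁, two h₂ h₃⟩,
      hV₂V ⟨a₆, two h₄ h₅, two h₆ (refl_mem_uniformity hE)⟩⟩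
  obtain ⟨D, hD, hDsh⟩ := hsh E hE
  obtain ⟨D₁, hD₁, -, hD₁D⟩ := comp_symm_mem_uniformity_sets hD
  obtain ⟨D₂, hD₂, hD₂s, hD₂D⟩ := comp_symm_mem_uniformity_sets hD₁
  have hDrefl : ∀ p, (p, p) ∈ D₂ := fun p => refl_mem_uniformity hD₂
  have hD4 : ∀ a₀ a₁ a₂ a₃ a₄, (a₀, a₁) ∈ D₂ → (a₁, a₂) ∈ D₂ → (a₂, a₃) ∈ D₂ →
      (a₃, a₄) ∈ D₂ → (a₀, a₄) ∈ D :=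
    fun a₀ a₁ a₂ a₃ a₄ h₀ h₁ h₂ h₃ => hD₁D ⟨a₂, hD₂D ⟨a₁, h₀, h₁⟩, hD₂D ⟨a₃, h₂, h₃⟩⟩
  -- a sensitive partner `y` of `x` such that `(x, y)` is in the closure of the recurrent set
  obtain ⟨W, hW, hWrec⟩ : ∃ W ∈ 𝓤 X, ∀ y (hy : y ∈ Y), (x, y) ∈ W →
      ((⟨x, hxY⟩ : Y), (⟨y, hy⟩ : Y)) ∈ closure (chainRecurrentSet (Prod.map g g)) := by
    have hnhds : {q : Y | ((⟨x, hxY⟩ : Y), q) ∈ closure (chainRecurrentSet (Prod.map g g))} ∈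
        nhds (⟨x, hxY⟩ : Y) :=
      (Continuous.prodMk_right (⟨x, hxY⟩ : Y)).continuousAt (mem_interior_iff_mem_nhds.1 hrec)
    rw [nhds_subtype_eq_comap, Filter.mem_comap] at hnhds
    obtain ⟨T, hT, hTsub⟩ := hnhds
    obtain ⟨W, hW, hWT⟩ := UniformSpace.mem_nhds_iff.1 hT
    exact ⟨W, hW, fun y hy hxy => hTsub (show y ∈ T from hWT hxy)⟩
  obtain ⟨E₁, hE₁, -, hE₁E⟩ := comp_symm_mem_uniformity_sets hE
  obtain ⟨y, hyY, ⟨⟨hxyW, hxyD⟩, hxyE⟩, n, hn⟩ :=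
    hsens (W ∩ D₂ ∩ E₁) (inter_mem (inter_mem hW hD₂) hE₁)
  have hclose : ∀ (z : Y) {F : Set (X × X)}, F ∈ 𝓤 X → ∀ m : ℕ,
      ∀ᶠ q : Y in nhds z, (f^[m] (z : X), f^[m] (q : X)) ∈ F := fun z F hF m =>
    ((hf.iterate m).comp continuous_subtype_val).continuousAt (UniformSpace.ball_mem_nhds _ hF)
  have hnear : ∀ᶠ p in nhds ((⟨x, hxY⟩ : Y), (⟨y, hyY⟩ : Y)),
      ((x, (p.1 : X)) ∈ D₂ ∩ E ∧ (f^[n] x, f^[n] (p.1 : X)) ∈ E) ∧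
      ((y, (p.2 : X)) ∈ D₂ ∩ E₁ ∧ (f^[n] y, f^[n] (p.2 : X)) ∈ E) := by
    rw [nhds_prod_eq]
    exact ((hclose ⟨x, hxY⟩ (inter_mem hD₂ hE) 0).and (hclose ⟨x, hxY⟩ hE n)).prod_mk
      ((hclose ⟨y, hyY⟩ (inter_mem hD₂ hE₁) 0).and (hclose ⟨y, hyY⟩ hE n))
  obtain ⟨⟨a, b⟩, ⟨⟨⟨hxaD, hxaE⟩, hxan⟩, ⟨hybD, hybE⟩, hybn⟩, hab⟩ :=
    mem_closure_iff_nhds.1 (hWrec y hyY hxyW) _ hnear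
  have hxbE : (x, (b : X)) ∈ E := hE₁E ⟨y, hxyE, hybE⟩
  -- a long closed chain of `g × g` at `(a, b)` provides the two blocks
  have hpull : ∀ {F : Set (X × X)}, F ∈ 𝓤 X →
      {q : (Y × Y) × (Y × Y) | ((q.1.1 : X), (q.2.1 : X)) ∈ F ∧
        ((q.1.2 : X), (q.2.2 : X)) ∈ F} ∈ 𝓤 (Y × Y) := fun {F} hF =>
    inter_mem
      ((uniformContinuous_subtype_val.comp uniformContinuous_fst) hF)
      ((uniformContinuous_subtype_val.comp uniformContinuous_snd) hF)
  obtain ⟨k, hnk, v, hv0, hvk, hvD, hvE⟩ := exists_closed_chain_of_mem_chainRecurrentSet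
    (hgc.prodMap hgc) hab n (hpull hD₂) (hpull hE)
  rw [hiter] at hvE
  simp only [mem_ofPred_eq, hcoe] at hvE
  let c : Bool → ℕ → X := fun s i => if s then ((v i).1 : X) else ((v i).2 : X)
  have hcD₂ : ∀ s i, (f (c s i), c s (i + 1)) ∈ D₂ := by
    intro s i
    cases s
    · exact (hvD i).2
    · exact (hvD i).1
  have hck : ∀ s, c s k = c s 0 := by
    intro s
    cases s <;> simp [c, hv0, hvk]
  have hcD : ∀ s i, (f (c s i), c s (i + 1)) ∈ D := fun s i =>
    hD4 _ _ _ _ _ (hcD₂ s i) (hDrefl _) (hDrefl _) (hDrefl _)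
  have hD₂symm : ∀ p q, (p, q) ∈ D₂ → (q, p) ∈ D₂ := fun p q h => hD₂s.symm _ _ h
  have hjoin : ∀ s t, (f (c s (k - 1)), c t 0) ∈ D := by
    intro s t
    have h₀ := hcD₂ s (k - 1)
    rw [show k - 1 + 1 = k by omega, hck] at h₀
    rcases s with _ | _ <;> rcases t with _ | _ <;>
      simp only [c, hv0, if_true, if_false, Bool.false_eq_true] at h₀ ⊢
    · exact hD4 _ _ _ _ _ h₀ (hDrefl _) (hDrefl _) (hDrefl _)
    · exact hD4 _ _ _ _ _ h₀ (hD₂symm _ _ hybD) (hD₂symm _ _ hxyD) hxaD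
    · exact hD4 _ _ _ _ _ h₀ (hD₂symm _ _ hxaD) hxyD hybD
    · exact hD4 _ _ _ _ _ h₀ (hDrefl _) (hDrefl _) (hDrefl _)
  have hfar : ∀ p q, (p, c true n) ∈ E → (q, c false n) ∈ E → (p, q) ∉ E := by
    intro p q hp hq hpq
    exact hn (hE8 _ _ _ _ _ _ _ _ hxan hvE.1 (hEs _ _ hp) hpq hq (hEs _ _ hvE.2)
      (hEs _ _ hybn))
  have hsep : ∀ s t, s ≠ t → ∀ p q, (p, c s n) ∈ E → (q, c t n) ∈ E → (p, q) ∉ E := by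
    intro s t hst p q hp hq hpq
    rcases s with _ | _ <;> rcases t with _ | _
    · exact hst rfl
    · exact hfar q p hq hp (hEs _ _ hpq)
    · exact hfar p q hp hq hpq
    · exact hst rfl
  have hshadow : ∀ s : ℕ → Bool, ∃ w ∈ closure O,
      ∀ m, (f^[m] w, c (s (m / k)) (m % k)) ∈ E := by
    intro s
    obtain ⟨w, hw⟩ := hDsh (fun m => c (s (m / k)) (m % k))
      (pseudoOrbit_concat (by omega) c (fun s i _ => hcD s i) hjoin s)
    refine ⟨w, subset_closure (hUO ?_), hw⟩
    have hxc : (x, c (s 0) 0) ∈ E := by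
      rcases s 0 with _ | _ <;> simpa [c, hv0]
    have hw0 : (w, c (s 0) 0) ∈ E := by simpa using hw 0
    exact hU₁U ⟨c (s 0) 0, (hEV hxc).2, (hEV (hEs _ _ hw0)).2⟩
  exact lt_of_lt_of_le
    (sepEntropyEntourage_pos_of_blocks (fun p => refl_mem_uniformity hE) hnk c hsep hshadow)
    (le_iSup₂_of_le E hE le_rfl)
end
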